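/- arXiv:2402.19147 — 6 statements merged into one kernel-verified Lean document; each statement's English description precedes it below -/
import Mathlib

section
/- For every m×n quaternion matrix A there exists an n×m quaternion matrix U satisfying the four Penrose equations A U A = A, U A U = U, (A U)ᴴ = A U, and (U A)ᴴ = U A; that is, every quaternion matrix admits a Moore–Penrose pseudoinverse. -/
open Matrix

/-- The Frobenius norm of a quaternion matrix: `√(∑ i j, |A i j|²)`. -/
noncomputable def frobNorm {α β : Type*} [Fintype α] [Fintype β]
    (A : Matrix α β (Quaternion ℝ)) : ℝ :=
  Real.sqrt (∑ i, ∑ j, ‖A i j‖ ^ 2)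

/-- `U` is a Moore–Penrose pseudoinverse of `A`:
`A U A = A`, `U A U = U`, `(A U)ᴴ = A U`, `(U A)ᴴ = U A`. -/
def IsMoorePenrose {α β : Type*} [Fintype α] [Fintype β]
    (A : Matrix α β (Quaternion ℝ)) (U : Matrix β α (Quaternion ℝ)) : Prop :=
  A * U * A = A ∧ U * A * U = U ∧ (A * U)ᴴ = A * U ∧ (U * A)ᴴ = U * A

theorem quat_self_zero {m n : ℕ} (C : Matrix (Fin m) (Fin n) (Quaternion ℝ))
    (h : Cᴴ * C = 0) : C = 0 := by
  ext1 i j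
  have h1 := congrFun (congrFun h j) j
  simp only [Matrix.mul_apply, Matrix.conjTranspose_apply, Matrix.zero_apply,
    Quaternion.star_mul_self] at h1
  have h2 : ∑ x, Quaternion.normSq (C x j) = 0 := by
    apply (algebraMap ℝ (Quaternion ℝ)).injective
    rw [map_sum, map_zero]
    exact h1
  rw [Finset.sum_eq_zero_iff_of_nonneg (fun _ _ => Quaternion.normSq_nonneg)] at h2
  exact Quaternion.normSq_eq_zero.1 (h2 i (Finset.mem_univ _))

theorem quat_cancel {m n k : ℕ} (A : Matrix (Fin m) (Fin n) (Quaternion ℝ))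
    (X : Matrix (Fin n) (Fin k) (Quaternion ℝ)) (h : Aᴴ * A * X = 0) : A * X = 0 := by
  apply quat_self_zero
  rw [Matrix.conjTranspose_mul, Matrix.mul_assoc, ← Matrix.mul_assoc Aᴴ, h, Matrix.mul_zero]

theorem quat_sq_range {n : ℕ} (H : Matrix (Fin n) (Fin n) (Quaternion ℝ)) (hH : Hᴴ = H) :
    ∃ R, H * H * R = H := by
  let f : Matrix (Fin n) (Fin n) (Quaternion ℝ) →ₗ[ℝ] Matrix (Fin n) (Fin n) (Quaternion ℝ) :=
    LinearMap.mulLeft ℝ H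
  have hk : LinearMap.ker (f ∘ₗ f) = LinearMap.ker f := by
    ext X
    simp only [LinearMap.mem_ker, LinearMap.comp_apply, f, LinearMap.mulLeft_apply]
    constructor
    · intro h
      apply quat_cancel
      rw [hH, Matrix.mul_assoc, h]
    · intro h
      rw [h, Matrix.mul_zero]
  have hr : LinearMap.range (f ∘ₗ f) = LinearMap.range f := by
    apply Submodule.eq_of_le_of_finrank_eq (LinearMap.range_comp_le_range f f)
    have h1 := LinearMap.finrank_range_add_finrank_ker (f ∘ₗ f)
    have h2 := LinearMap.finrank_range_add_finrank_ker f
    rw [hk] at h1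
    omega
  have : H ∈ LinearMap.range f := ⟨1, by simp [f]⟩
  rw [← hr] at this
  obtain ⟨R, hR⟩ := this
  exact ⟨R, by rw [Matrix.mul_assoc]; simpa [f] using hR⟩

/-- Every quaternion matrix admits a Moore–Penrose pseudoinverse. -/
theorem quaternion_moorePenrose_exists {m n : ℕ}
    (A : Matrix (Fin m) (Fin n) (Quaternion ℝ)) :
    ∃ U : Matrix (Fin n) (Fin m) (Quaternion ℝ), IsMoorePenrose A U := by
  obtain ⟨H, hHA⟩ : ∃ H, H = Aᴴ * A := ⟨_, rfl⟩
  have hH : Hᴴ = H := by rw [hHA]; simp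
  obtain ⟨R, hR⟩ := quat_sq_range H hH
  have hR' : Rᴴ * (H * H) = H := by
    have := congrArg Matrix.conjTranspose hR
    simpa [hH] using this
  have hc : H * R = Rᴴ * H := by
    calc H * R = Rᴴ * (H * H) * R := by rw [hR']
      _ = Rᴴ * H := by rw [Matrix.mul_assoc, hR]
  obtain ⟨S, hSd⟩ : ∃ S, S = Rᴴ * H * R := ⟨_, rfl⟩
  have hS : Sᴴ = S := by rw [hSd]; simp [hH, Matrix.mul_assoc]
  have hHS : H * S = H * R := by
    rw [hSd, ← hc, ← Matrix.mul_assoc, ← Matrix.mul_assoc, hR]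
  have hSH : S * H = H * R := by
    have := congrArg Matrix.conjTranspose hHS
    simp only [Matrix.conjTranspose_mul, hS, hH] at this
    rw [this, hc]
  have hA : A * (S * H) = A := by
    have : A * (S * H - 1) = 0 := by
      apply quat_cancel
      rw [← hHA, hSH, Matrix.mul_sub, ← Matrix.mul_assoc, hR, Matrix.mul_one, sub_self]
    rwa [Matrix.mul_sub, Matrix.mul_one, sub_eq_zero] at this
  have hA' : H * S * Aᴴ = Aᴴ := by
    have := congrArg Matrix.conjTranspose hA
    simpa only [Matrix.conjTranspose_mul, hS, hH] using this
  have hUA : S * Aᴴ * A = S * H := by rw [hHA, Matrix.mul_assoc]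
  refine ⟨S * Aᴴ, ?_, ?_, ?_, ?_⟩
  · rw [Matrix.mul_assoc, hUA, hA]
  · rw [hUA, Matrix.mul_assoc, ← Matrix.mul_assoc H, hA']
  · simp [hS, Matrix.mul_assoc]
  · rw [hUA, Matrix.conjTranspose_mul, hS, hH, hHS, hSH]
end

section
/- Optimality of the core matrix in the quaternion CUR approximation: let X be an m×n quaternion matrix, C an m×s quaternion matrix, R a t×n quaternion matrix, and let C⁺ and R⁺ be Moore–Penrose pseudoinverses of C and R respectively. Then the choice U = C⁺ X R⁺ minimizes the Frobenius-norm error: for every s×t quaternion matrix Z, ‖X − C (C⁺ X R⁺) R‖_F ≤ ‖X − C Z R‖_F. -/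
open Matrix

lemma retr_comm {m n : ℕ} (A : Matrix (Fin m) (Fin n) (Quaternion ℝ))
    (B : Matrix (Fin n) (Fin m) (Quaternion ℝ)) :
    (∑ i, ((A * B) i i).re) = ∑ j, ((B * A) j j).re := by
  have hs : ∀ {k : ℕ} (f : Fin k → Quaternion ℝ), (∑ i, f i).re = ∑ i, (f i).re := by
    intro k f
    induction k with
    | zero => simp; rfl
    | succ k ih => simp [Fin.sum_univ_succ, ih]
  simp only [Matrix.mul_apply, hs]
  rw [Finset.sum_comm]
  refine Finset.sum_congr rfl fun j _ => Finset.sum_congr rfl fun i _ => ?_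
  simp only [Quaternion.re_mul]
  ring

lemma retr_eq {m n : ℕ} (A B : Matrix (Fin m) (Fin n) (Quaternion ℝ)) :
    (∑ i, ((A * Bᴴ) i i).re) = ∑ i, ∑ j, inner ℝ (A i j) (B i j) := by
  have hs : ∀ {k : ℕ} (f : Fin k → Quaternion ℝ), (∑ i, f i).re = ∑ i, (f i).re := by
    intro k f
    induction k with
    | zero => simp; rfl
    | succ k ih => simp [Fin.sum_univ_succ, ih]
  simp only [Matrix.mul_apply, hs, Quaternion.inner_def, Matrix.conjTranspose_apply]

lemma frob_le {m n : ℕ} (A D : Matrix (Fin m) (Fin n) (Quaternion ℝ))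
    (h : (∑ i, ((A * Dᴴ) i i).re) = 0) : frobNorm A ≤ frobNorm (A + D) := by
  unfold frobNorm
  apply Real.sqrt_le_sqrt
  rw [retr_eq] at h
  have h2 : (∑ i, ∑ j, ‖(A + D) i j‖ ^ 2) = (∑ i, ∑ j, ‖A i j‖ ^ 2)
      + 2 * (∑ i, ∑ j, inner ℝ (A i j) (D i j)) + ∑ i, ∑ j, ‖D i j‖ ^ 2 := by
    simp only [Matrix.add_apply, norm_add_sq_real, Finset.sum_add_distrib, Finset.mul_sum]
  rw [h2, h]
  have : 0 ≤ ∑ i, ∑ j, ‖D i j‖ ^ 2 := by positivity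
  linarith

/-- The core matrix `U = C⁺ X R⁺` minimizes the Frobenius-norm error
of the quaternion CUR approximation. -/
theorem quaternion_CUR_core_optimal {m n s t : ℕ}
    (X : Matrix (Fin m) (Fin n) (Quaternion ℝ))
    (C : Matrix (Fin m) (Fin s) (Quaternion ℝ))
    (R : Matrix (Fin t) (Fin n) (Quaternion ℝ))
    (Cp : Matrix (Fin s) (Fin m) (Quaternion ℝ)) (hCp : IsMoorePenrose C Cp)
    (Rp : Matrix (Fin n) (Fin t) (Quaternion ℝ)) (hRp : IsMoorePenrose R Rp) :
    ∀ Z : Matrix (Fin s) (Fin t) (Quaternion ℝ),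
      frobNorm (X - C * (Cp * X * Rp) * R) ≤ frobNorm (X - C * Z * R) := by
  intro Z
  obtain ⟨c1, -, c3, -⟩ := hCp
  obtain ⟨r1, -, -, r4⟩ := hRp
  have hX : X - C * Z * R = (X - C * (Cp * X * Rp) * R) + (C * (Cp * X * Rp - Z) * R) := by
    rw [Matrix.mul_sub, Matrix.sub_mul]; abel
  rw [hX]
  apply frob_le
  set W := Cp * X * Rp - Z
  have hD : (C * W * R)ᴴ = (Rp * R) * ((C * W * R)ᴴ * (C * Cp)) := by
    have : C * W * R = (C * Cp) * (C * W * R) * (Rp * R) := by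
      calc C * W * R = (C * Cp * C) * W * (R * Rp * R) := by rw [c1, r1]
        _ = _ := by simp only [Matrix.mul_assoc]
    conv_lhs => rw [this]
    rw [Matrix.conjTranspose_mul, Matrix.conjTranspose_mul (C * Cp), c3, r4]
  have hA : (C * Cp) * ((X - C * (Cp * X * Rp) * R) * (Rp * R)) = 0 := by
    have : (C * Cp) * ((C * (Cp * X * Rp) * R) * (Rp * R)) = (C * Cp) * (X * (Rp * R)) := by
      calc _ = (C * Cp * C) * (Cp * X * Rp) * (R * Rp * R) := by simp only [Matrix.mul_assoc]
        _ = C * (Cp * X * Rp) * R := by rw [c1, r1]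
        _ = _ := by simp only [Matrix.mul_assoc]
    rw [Matrix.sub_mul, Matrix.mul_sub, this, sub_self]
  rw [hD, ← Matrix.mul_assoc, ← Matrix.mul_assoc, retr_comm, ← Matrix.mul_assoc, hA]
  simp only [Matrix.zero_mul, Matrix.zero_apply]
  exact Finset.sum_eq_zero fun _ _ => rfl
end

section
/- Pseudoinverse of a factored quaternion matrix: let W_I be a t×k quaternion matrix admitting a Moore–Penrose pseudoinverse W_I⁺ with W_I⁺ W_I = I_k (full column rank), let Σ be a k×k diagonal matrix whose diagonal entries are positive real numbers (viewed as quaternions), and let V be an n×k quaternion matrix with Vᴴ V = I_k. Then the matrix V Σ⁻¹ W_I⁺ is a Moore–Penrose pseudoinverse of W_I Σ Vᴴ, i.e., it satisfies the four Penrose equations with respect to W_I Σ Vᴴ. -/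
open Matrix

/-- `V Σ⁻¹ W_I⁺` is a Moore–Penrose pseudoinverse of `W_I Σ Vᴴ`, where
`W_I` has full column rank (so `W_I⁺ W_I = I`), `Σ` is diagonal with positive real
entries, and `V` has orthonormal columns. -/
theorem quaternion_pinv_of_factored {t k n : ℕ}
    (WI : Matrix (Fin t) (Fin k) (Quaternion ℝ))
    (WIp : Matrix (Fin k) (Fin t) (Quaternion ℝ))
    (hWIp : IsMoorePenrose WI WIp) (hfull : WIp * WI = 1)
    (d : Fin k → ℝ) (hd : ∀ i, 0 < d i)
    (V : Matrix (Fin n) (Fin k) (Quaternion ℝ)) (hV : Vᴴ * V = 1) :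
    IsMoorePenrose (WI * Matrix.diagonal (fun i => ((d i : ℝ) : Quaternion ℝ)) * Vᴴ)
      (V * Matrix.diagonal (fun i => (((d i)⁻¹ : ℝ) : Quaternion ℝ)) * WIp) := by
  obtain ⟨-, -, h3, -⟩ := hWIp
  have e1 : Matrix.diagonal (fun i => ((d i : ℝ) : Quaternion ℝ)) *
      Matrix.diagonal (fun i => (((d i)⁻¹ : ℝ) : Quaternion ℝ)) = 1 := by
    rw [Matrix.diagonal_mul_diagonal, ← Matrix.diagonal_one]
    congr 1
    funext i
    rw [← Quaternion.coe_mul, mul_inv_cancel₀ (hd i).ne', Quaternion.coe_one]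
  have e2 : Matrix.diagonal (fun i => (((d i)⁻¹ : ℝ) : Quaternion ℝ)) *
      Matrix.diagonal (fun i => ((d i : ℝ) : Quaternion ℝ)) = 1 := by
    rw [Matrix.diagonal_mul_diagonal, ← Matrix.diagonal_one]
    congr 1
    funext i
    rw [← Quaternion.coe_mul, inv_mul_cancel₀ (hd i).ne', Quaternion.coe_one]
  generalize Matrix.diagonal (fun i => ((d i : ℝ) : Quaternion ℝ)) = S at *
  generalize Matrix.diagonal (fun i => (((d i)⁻¹ : ℝ) : Quaternion ℝ)) = T at *
  have a1 : (WI * S * Vᴴ) * (V * T * WIp) = WI * WIp := by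
    calc _ = WI * (S * ((Vᴴ * V) * T)) * WIp := by simp only [Matrix.mul_assoc]
      _ = _ := by rw [hV, Matrix.one_mul, e1, Matrix.mul_one]
  have a2 : (V * T * WIp) * (WI * S * Vᴴ) = V * Vᴴ := by
    calc _ = V * (T * ((WIp * WI) * S)) * Vᴴ := by simp only [Matrix.mul_assoc]
      _ = _ := by rw [hfull, Matrix.one_mul, e2, Matrix.mul_one]
  refine ⟨?_, ?_, ?_, ?_⟩
  · rw [a1]
    calc _ = WI * (WIp * WI) * S * Vᴴ := by simp only [Matrix.mul_assoc]
      _ = _ := by rw [hfull, Matrix.mul_one]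
  · rw [a2]
    calc _ = V * (Vᴴ * V) * T * WIp := by simp only [Matrix.mul_assoc]
      _ = _ := by rw [hV, Matrix.mul_one]
  · rw [a1, h3]
  · rw [a2, Matrix.conjTranspose_mul, Matrix.conjTranspose_conjTranspose]
end

section
/- (Lemma 3, first equality) Let X = W Σ Vᴴ be an m×n quaternion matrix of rank k, where W is m×k with Wᴴ W = I_k, V is n×k with Vᴴ V = I_k, and Σ is a k×k diagonal matrix with positive real diagonal entries. Let R = X(I,:) be the row submatrix of X selected by a map r : {1,…,t} → {1,…,m} and let W_I = W(I,:) be the corresponding row submatrix of W. Assume W_I admits a Moore–Penrose pseudoinverse W_I⁺ with W_I⁺ W_I = I_k, and let R⁺ be a Moore–Penrose pseudoinverse of R. Then ‖X R⁺‖_F = ‖W_I⁺‖_F. -/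
open Matrix

theorem aux_diag {α β : Type*} [Fintype α] [Fintype β]
    (A : Matrix α β (Quaternion ℝ)) (j : β) :
    ((∑ i, ‖A i j‖ ^ 2 : ℝ) : Quaternion ℝ) = (Aᴴ * A) j j := by
  rw [Matrix.mul_apply]
  have h : ∀ i, Aᴴ j i * A i j = ((‖A i j‖ ^ 2 : ℝ) : Quaternion ℝ) := by
    intro i
    rw [Matrix.conjTranspose_apply, Quaternion.star_mul_self, Quaternion.normSq_eq_norm_mul_self,
      pow_two]
  simp only [h]
  exact map_sum (algebraMap ℝ (Quaternion ℝ)) _ _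

theorem aux_frob {α β γ : Type*} [Fintype α] [Fintype β] [Fintype γ]
    (A : Matrix α β (Quaternion ℝ)) (B : Matrix γ β (Quaternion ℝ))
    (h : Aᴴ * A = Bᴴ * B) : frobNorm A = frobNorm B := by
  unfold frobNorm
  rw [Finset.sum_comm, Finset.sum_comm (s := (Finset.univ : Finset γ))]
  congr 1
  refine Finset.sum_congr rfl fun j _ => ?_
  apply Quaternion.coe_injective
  rw [aux_diag, aux_diag, h]

/-- Lemma 3, first equality: for `X = W Σ Vᴴ` of rank `k` and a row
submatrix `R = X(I,:)` with `W_I = W(I,:)` of full column rank, `‖X R⁺‖_F = ‖W_I⁺‖_F`. -/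
theorem quaternion_CUR_XRp_norm {m n k t : ℕ}
    (W : Matrix (Fin m) (Fin k) (Quaternion ℝ)) (hW : Wᴴ * W = 1)
    (V : Matrix (Fin n) (Fin k) (Quaternion ℝ)) (hV : Vᴴ * V = 1)
    (d : Fin k → ℝ) (hd : ∀ i, 0 < d i)
    (X : Matrix (Fin m) (Fin n) (Quaternion ℝ))
    (hX : X = W * Matrix.diagonal (fun i => ((d i : ℝ) : Quaternion ℝ)) * Vᴴ)
    (r : Fin t → Fin m)
    (R : Matrix (Fin t) (Fin n) (Quaternion ℝ)) (hR : R = X.submatrix r id)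
    (WI : Matrix (Fin t) (Fin k) (Quaternion ℝ)) (hWI : WI = W.submatrix r id)
    (WIp : Matrix (Fin k) (Fin t) (Quaternion ℝ))
    (hWIp : IsMoorePenrose WI WIp) (hfull : WIp * WI = 1)
    (Rp : Matrix (Fin n) (Fin t) (Quaternion ℝ)) (hRp : IsMoorePenrose R Rp) :
    frobNorm (X * Rp) = frobNorm WIp := by
  obtain ⟨h1, -, h3, -⟩ := hRp
  obtain ⟨g1, -, g3, -⟩ := hWIp
  set D : Matrix (Fin k) (Fin k) (Quaternion ℝ) :=
    Matrix.diagonal (fun i => ((d i : ℝ) : Quaternion ℝ)) with hD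
  obtain ⟨E, hE⟩ : ∃ E, D * E = 1 := by
    refine ⟨Matrix.diagonal (fun i => (((d i)⁻¹ : ℝ) : Quaternion ℝ)), ?_⟩
    rw [hD, Matrix.diagonal_mul_diagonal, ← Matrix.diagonal_one]
    congr 1
    funext i
    rw [← Quaternion.coe_mul, mul_inv_cancel₀ (hd i).ne', Quaternion.coe_one]
  have hRW : R = WI * (D * Vᴴ) := by
    rw [hR, hX, hWI, Matrix.mul_assoc]
    rfl
  have hinv : (D * Vᴴ) * (V * E) = 1 := by
    rw [Matrix.mul_assoc, ← Matrix.mul_assoc Vᴴ, hV, Matrix.one_mul, hE]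
  obtain ⟨B, hB⟩ : ∃ B, B = (D * Vᴴ) * Rp := ⟨_, rfl⟩
  have hRB : R * Rp = WI * B := by rw [hRW, hB, Matrix.mul_assoc]
  have hXB : X * Rp = W * B := by rw [hX, hB]; simp only [Matrix.mul_assoc]
  rw [hRB] at h1 h3
  have h4 : WI * B * WI = WI := by
    have hRV : R * (V * E) = WI := by
      rw [hRW, Matrix.mul_assoc WI, hinv, Matrix.mul_one]
    calc WI * B * WI = WI * B * (R * (V * E)) := by rw [hRV]
      _ = (WI * B * R) * (V * E) := by rw [Matrix.mul_assoc (WI * B)]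
      _ = WI := by rw [h1, hRV]
  have h5 : WI * B = WI * WIp := by
    calc WI * B = (WI * WIp) * (WI * B) := by rw [← Matrix.mul_assoc, g1]
      _ = (WI * WIp)ᴴ * (WI * B)ᴴ := by rw [g3, h3]
      _ = (WI * B * WI * WIp)ᴴ := by rw [← Matrix.conjTranspose_mul, ← Matrix.mul_assoc]
      _ = WI * WIp := by rw [h4, g3]
  have h6 : B = WIp := by
    have := congrArg (WIp * ·) h5
    simpa only [← Matrix.mul_assoc, hfull, Matrix.one_mul] using this
  rw [hXB, h6]
  apply aux_frob
  rw [Matrix.conjTranspose_mul, Matrix.mul_assoc, ← Matrix.mul_assoc Wᴴ, hW, Matrix.one_mul]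
end

section
/- (Lemma 3, second equality) Let X = W Σ Vᴴ be an m×n quaternion matrix of rank k, where W is m×k with Wᴴ W = I_k, V is n×k with Vᴴ V = I_k, and Σ is a k×k diagonal matrix with positive real diagonal entries. Let C = X(:,J) be the column submatrix of X selected by a map c : {1,…,s} → {1,…,n} and let V_J = V(J,:) be the corresponding row submatrix of V. Assume V_J admits a Moore–Penrose pseudoinverse V_J⁺ with V_J⁺ V_J = I_k, and let C⁺ be a Moore–Penrose pseudoinverse of C. Then ‖C⁺ X‖_F = ‖V_J⁺‖_F. -/
open Matrix

theorem aux_row {α β : Type*} [Fintype α] [Fintype β]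
    (A : Matrix α β (Quaternion ℝ)) (i : α) :
    ∑ j, ‖A i j‖ ^ 2 = ((A * Aᴴ) i i).re := by
  have h : (A * Aᴴ) i i = ((∑ j, ‖A i j‖ ^ 2 : ℝ) : Quaternion ℝ) := by
    rw [Matrix.mul_apply]; refine Eq.trans ?_ (map_sum (algebraMap ℝ (Quaternion ℝ)) (fun j => ‖A i j‖ ^ 2) Finset.univ).symm
    refine Finset.sum_congr rfl fun j _ => ?_
    rw [Matrix.conjTranspose_apply, Quaternion.self_mul_star,
      Quaternion.normSq_eq_norm_mul_self, pow_two]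
    rfl
  rw [h, Quaternion.re_coe]

/-- Lemma 3, second equality: for `X = W Σ Vᴴ` of rank `k` and a column
submatrix `C = X(:,J)` with `V_J = V(J,:)` of full column rank, `‖C⁺ X‖_F = ‖V_J⁺‖_F`. -/
theorem quaternion_CUR_CpX_norm {m n k s : ℕ}
    (W : Matrix (Fin m) (Fin k) (Quaternion ℝ)) (hW : Wᴴ * W = 1)
    (V : Matrix (Fin n) (Fin k) (Quaternion ℝ)) (hV : Vᴴ * V = 1)
    (d : Fin k → ℝ) (hd : ∀ i, 0 < d i)
    (X : Matrix (Fin m) (Fin n) (Quaternion ℝ))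
    (hX : X = W * Matrix.diagonal (fun i => ((d i : ℝ) : Quaternion ℝ)) * Vᴴ)
    (c : Fin s → Fin n)
    (C : Matrix (Fin m) (Fin s) (Quaternion ℝ)) (hC : C = X.submatrix id c)
    (VJ : Matrix (Fin s) (Fin k) (Quaternion ℝ)) (hVJ : VJ = V.submatrix c id)
    (VJp : Matrix (Fin k) (Fin s) (Quaternion ℝ))
    (hVJp : IsMoorePenrose VJ VJp) (hfull : VJp * VJ = 1)
    (Cp : Matrix (Fin s) (Fin m) (Quaternion ℝ)) (hCp : IsMoorePenrose C Cp) :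
    frobNorm (Cp * X) = frobNorm VJp := by
  obtain ⟨h1, -, -, h4⟩ := hCp
  obtain ⟨-, g2, g3, -⟩ := hVJp
  set D : Matrix (Fin k) (Fin k) (Quaternion ℝ) :=
    Matrix.diagonal (fun i => ((d i : ℝ) : Quaternion ℝ)) with hD
  have hDi : Matrix.diagonal (fun i => (((d i)⁻¹ : ℝ) : Quaternion ℝ)) * D = 1 := by
    rw [hD, Matrix.diagonal_mul_diagonal, ← Matrix.diagonal_one]
    congr 1
    funext i
    rw [← Quaternion.coe_mul, inv_mul_cancel₀ (hd i).ne', Quaternion.coe_one]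
  set Di := Matrix.diagonal (fun i => (((d i)⁻¹ : ℝ) : Quaternion ℝ))
  have hC2 : C = W * D * VJᴴ := by
    rw [hC, hX, hVJ]
    rfl
  have hL : (Di * Wᴴ) * (W * D) = 1 := by
    rw [Matrix.mul_assoc, ← Matrix.mul_assoc Wᴴ, hW, Matrix.one_mul, hDi]
  have hE : VJᴴ * (Cp * C) = VJᴴ := by
    have h : (Di * Wᴴ) * (C * Cp * C) = (Di * Wᴴ) * C := by rw [h1]
    rw [Matrix.mul_assoc C] at h
    have hLC : (Di * Wᴴ) * C = VJᴴ := by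
      rw [hC2, ← Matrix.mul_assoc, hL, Matrix.one_mul]
    rw [← Matrix.mul_assoc, hLC] at h
    exact h
  have hE2 : (Cp * C) * VJ = VJ := by
    have h := congrArg Matrix.conjTranspose hE
    rwa [Matrix.conjTranspose_mul, h4, Matrix.conjTranspose_conjTranspose] at h
  have hP : VJ * (VJp * VJpᴴ) = VJpᴴ := by
    have h := congrArg Matrix.conjTranspose g2
    rw [Matrix.mul_assoc, Matrix.conjTranspose_mul] at h
    have h' : (VJ * VJp)ᴴ * VJpᴴ = VJpᴴ := by
      rw [← Matrix.conjTranspose_mul, ← Matrix.mul_assoc, g2]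
    rwa [g3, Matrix.mul_assoc] at h'
  have hI : VJᴴ * VJpᴴ = 1 := by
    rw [← Matrix.conjTranspose_mul, hfull, Matrix.conjTranspose_one]
  have hK : Cp * (W * D) = VJpᴴ := by
    calc Cp * (W * D) = (Cp * C) * VJpᴴ := by
          rw [hC2, Matrix.mul_assoc, Matrix.mul_assoc (W * D), hI, Matrix.mul_one]
      _ = (Cp * C) * (VJ * (VJp * VJpᴴ)) := by rw [hP]
      _ = VJpᴴ := by rw [← Matrix.mul_assoc, hE2, hP]
  have hCX : Cp * X = VJpᴴ * Vᴴ := by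
    rw [hX, ← Matrix.mul_assoc, hK]
  have hG : (Cp * X) * (Cp * X)ᴴ = VJpᴴ * (VJpᴴ)ᴴ := by
    rw [hCX, Matrix.conjTranspose_mul, Matrix.conjTranspose_conjTranspose V,
      Matrix.mul_assoc, ← Matrix.mul_assoc Vᴴ, hV, Matrix.one_mul]
  unfold frobNorm
  congr 1
  simp_rw [aux_row (Cp * X), hG, ← aux_row]
  rw [Finset.sum_comm]
  simp [Matrix.conjTranspose_apply]
end

section
/- (Lemma 2, first inequality) Let X and E be m×n quaternion matrices and set X̃ = X + E. Fix a column-selection map c : {1,…,s} → {1,…,n} and let C = X(:,J), C̃ = X̃(:,J), and E_J = E(:,J) be the corresponding column submatrices (so C̃ = C + E_J). Let C⁺ and C̃⁺ be Moore–Penrose pseudoinverses of C and C̃, and assume X = C C⁺ X. Then ‖X − C̃ C̃⁺ X̃‖_F ≤ ‖E_J‖_F · ‖C⁺ X‖_F + ‖E‖_F. -/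
open Matrix

theorem frobNorm_sq_aux {α β : Type*} [Fintype α] [Fintype β]
    (A : Matrix α β (Quaternion ℝ)) :
    ∑ i, ∑ j, ‖A i j‖ ^ 2 = ∑ j, ((Aᴴ * A) j j).re := by
  rw [Finset.sum_comm]
  refine Finset.sum_congr rfl fun j _ => ?_
  have h : ∀ (t : Finset α) (f : α → Quaternion ℝ), (∑ i ∈ t, f i).re = ∑ i ∈ t, (f i).re := by
    intro t f
    classical
    induction t using Finset.induction_on with
    | empty => rfl
    | insert a t ha ih => rw [Finset.sum_insert ha, Finset.sum_insert ha, ← ih]; rfl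
  rw [Matrix.mul_apply, h]
  refine Finset.sum_congr rfl fun i _ => ?_
  rw [Matrix.conjTranspose_apply, Quaternion.star_mul_self, Quaternion.re_coe,
    Quaternion.normSq_eq_norm_mul_self, sq]

theorem frobNorm_proj_le {α β : Type*} [Fintype α] [Fintype β] [DecidableEq α]
    (P : Matrix α α (Quaternion ℝ)) (hP : P * P = P) (hH : Pᴴ = P)
    (A : Matrix α β (Quaternion ℝ)) : frobNorm (P * A) ≤ frobNorm A := by
  have key : Aᴴ * A = (P * A)ᴴ * (P * A) + ((1 - P) * A)ᴴ * ((1 - P) * A) := by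
    have e1 : (P * A)ᴴ * (P * A) = Aᴴ * (P * A) := by
      rw [Matrix.conjTranspose_mul, hH, Matrix.mul_assoc, ← Matrix.mul_assoc P P, hP]
    have e2 : ((1 - P) * A)ᴴ * ((1 - P) * A) = Aᴴ * ((1 - P) * A) := by
      have h2 : (1 - P) * (1 - P) = 1 - P := by
        rw [Matrix.mul_sub, Matrix.sub_mul, Matrix.sub_mul, hP]; simp
      rw [Matrix.conjTranspose_mul, Matrix.conjTranspose_sub, hH, Matrix.conjTranspose_one,
        Matrix.mul_assoc, ← Matrix.mul_assoc (1 - P) (1 - P), h2]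
    rw [e1, e2, ← Matrix.mul_add, ← Matrix.add_mul]; simp
  unfold frobNorm
  apply Real.sqrt_le_sqrt
  have h3 : ∑ i, ∑ j, ‖A i j‖ ^ 2 = ∑ i, ∑ j, ‖(P * A) i j‖ ^ 2
      + ∑ i, ∑ j, ‖(((1 - P) * A : Matrix α β (Quaternion ℝ))) i j‖ ^ 2 := by
    rw [frobNorm_sq_aux A, frobNorm_sq_aux (P * A), frobNorm_sq_aux ((1 - P) * A), key,
      ← Finset.sum_add_distrib]
    rfl
  rw [h3]
  have : 0 ≤ ∑ i, ∑ j, ‖(((1 - P) * A : Matrix α β (Quaternion ℝ))) i j‖ ^ 2 := by positivity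
  linarith

theorem frobNorm_mul_le {α β γ : Type*} [Fintype α] [Fintype β] [Fintype γ]
    (A : Matrix α β (Quaternion ℝ)) (B : Matrix β γ (Quaternion ℝ)) :
    frobNorm (A * B) ≤ frobNorm A * frobNorm B := by
  unfold frobNorm
  rw [← Real.sqrt_mul (by positivity)]
  apply Real.sqrt_le_sqrt
  rw [Finset.sum_comm (f := fun i j => ‖B i j‖ ^ 2), Finset.sum_mul_sum]
  refine Finset.sum_le_sum fun i _ => Finset.sum_le_sum fun j _ => ?_
  refine le_trans ?_ (Finset.sum_mul_sq_le_sq_mul_sq _ _ _)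
  gcongr
  rw [Matrix.mul_apply]
  refine (norm_sum_le _ _).trans (Finset.sum_le_sum fun k _ => (norm_mul_le _ _))

attribute [local instance] Matrix.frobeniusNormedAddCommGroup in
theorem frobNorm_sub_le {α β : Type*} [Fintype α] [Fintype β]
    (A B : Matrix α β (Quaternion ℝ)) :
    frobNorm (A - B) ≤ frobNorm A + frobNorm B := by
  have h : ∀ M : Matrix α β (Quaternion ℝ), frobNorm M = ‖M‖ := by
    intro M
    rw [Matrix.frobenius_norm_def, frobNorm, Real.sqrt_eq_rpow]
    norm_cast
  rw [h, h, h]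
  exact norm_sub_le A B

theorem frobNorm_neg_eq {α β : Type*} [Fintype α] [Fintype β]
    (A : Matrix α β (Quaternion ℝ)) : frobNorm (-A) = frobNorm A := by
  simp [frobNorm]

/-- Lemma 2, first inequality. -/
theorem quaternion_CUR_col_perturbation {m n s : ℕ}
    (X E : Matrix (Fin m) (Fin n) (Quaternion ℝ))
    (Xt : Matrix (Fin m) (Fin n) (Quaternion ℝ)) (hXt : Xt = X + E)
    (c : Fin s → Fin n)
    (C : Matrix (Fin m) (Fin s) (Quaternion ℝ)) (hC : C = X.submatrix id c)
    (Ct : Matrix (Fin m) (Fin s) (Quaternion ℝ)) (hCt : Ct = Xt.submatrix id c)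
    (EJ : Matrix (Fin m) (Fin s) (Quaternion ℝ)) (hEJ : EJ = E.submatrix id c)
    (Cp : Matrix (Fin s) (Fin m) (Quaternion ℝ)) (hCp : IsMoorePenrose C Cp)
    (Ctp : Matrix (Fin s) (Fin m) (Quaternion ℝ)) (hCtp : IsMoorePenrose Ct Ctp)
    (hXCC : X = C * Cp * X) :
    frobNorm (X - Ct * Ctp * Xt) ≤ frobNorm EJ * frobNorm (Cp * X) + frobNorm E := by
  obtain ⟨h1, h2, h3, -⟩ := hCtp
  set P := Ct * Ctp with hPdef
  have hP : P * P = P := by rw [hPdef, ← Matrix.mul_assoc, h1]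
  have hQ : (1 - P) * (1 - P) = 1 - P := by
    rw [Matrix.mul_sub, Matrix.sub_mul, Matrix.sub_mul, hP]; simp
  have hQH : (1 - P)ᴴ = 1 - P := by
    rw [Matrix.conjTranspose_sub, h3, Matrix.conjTranspose_one]
  have hCE : C = Ct - EJ := by
    subst hC hCt hEJ hXt
    ext1 i j
    simp
  have hQC : (1 - P) * C = -((1 - P) * EJ) := by
    rw [hCE, Matrix.mul_sub, Matrix.sub_mul 1 P Ct, h1]; simp
  have hQX : (1 - P) * X = -((1 - P) * (EJ * (Cp * X))) := by
    conv_lhs => rw [hXCC]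
    rw [Matrix.mul_assoc C, ← Matrix.mul_assoc, hQC, Matrix.neg_mul, Matrix.mul_assoc]
  have e : X - P * Xt = (1 - P) * X - P * E := by
    rw [hXt, Matrix.mul_add, Matrix.sub_mul, Matrix.one_mul]; abel
  rw [e]
  refine (frobNorm_sub_le _ _).trans (add_le_add ?_ (frobNorm_proj_le P hP h3 E))
  rw [hQX, frobNorm_neg_eq]
  exact (frobNorm_proj_le _ hQ hQH _).trans (frobNorm_mul_le _ _)
end
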